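/- Let S be a positive definite symmetric integral m×m matrix and Ω ∈ H_n. Define θ_R(Ω') = Σ_{ξ∈ℤ^{(m,n)}} exp(πi σ(R ξ Ω' ᵗξ)) for a positive definite symmetric real m×m matrix R and Ω' ∈ H_n. Then −Ω^{-1} ∈ H_n, both series θ_S(Ω) and θ_{S^{-1}}(−Ω^{-1}) converge absolutely, and the theta inversion formula θ_{S^{-1}}(−Ω^{-1})² = (det S)^n · det(Ω/i)^m · θ_S(Ω)² holds. (Equivalently, θ_{S^{-1}}(−Ω^{-1}) = (det S)^{n/2} det(Ω/i)^{m/2} θ_S(Ω) for the branch of det(Ω/i)^{1/2} that is positive when Ω = iY with Y positive definite.) -/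

import Mathlib

open Matrix

/-- The term of the theta series `θ_R(Ω) = Σ_ξ exp(πi σ(R ξ Ω ᵗξ))`. -/
noncomputable def thetaSTerm {m n : ℕ} (R : Matrix (Fin m) (Fin m) ℝ)
    (Ω : Matrix (Fin n) (Fin n) ℂ) (ξ : Matrix (Fin m) (Fin n) ℤ) : ℂ :=
  Complex.exp ((Real.pi : ℂ) * Complex.I * Matrix.trace (R.map Complex.ofReal *
    ξ.map (Int.cast : ℤ → ℂ) * Ω * (ξ.map (Int.cast : ℤ → ℂ))ᵀ))

/-- The theta series `θ_R(Ω)` attached to a positive definite symmetric real matrix `R`. -/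
noncomputable def thetaS {m n : ℕ} (R : Matrix (Fin m) (Fin m) ℝ)
    (Ω : Matrix (Fin n) (Fin n) ℂ) : ℂ :=
  ∑' ξ : Matrix (Fin m) (Fin n) ℤ, thetaSTerm R Ω ξ


set_option linter.unusedSectionVars false

section ThetaAux

variable {ι : Type} [Fintype ι]

/-- The quadratic form attached to a complex matrix. -/
noncomputable def qfm (Z : Matrix ι ι ℂ) (x : ι → ℂ) : ℂ := x ⬝ᵥ (Z *ᵥ x)

/-- Integer vectors as complex vectors. -/
noncomputable def icv {κ : Type} (ξ : κ → ℤ) : κ → ℂ := fun i => ((ξ i : ℤ) : ℂ)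

/-- Real vectors as complex vectors. -/
noncomputable def rcv {κ : Type} (x : κ → ℝ) : κ → ℂ := fun i => ((x i : ℝ) : ℂ)

/-- Positivity of the imaginary part. -/
def ImPos (Z : Matrix ι ι ℂ) : Prop := ∀ x : ι → ℝ, x ≠ 0 → 0 < (qfm Z (rcv x)).im

lemma symm_dot {Z : Matrix ι ι ℂ} (hZ : Z.IsSymm) (x y : ι → ℂ) :
    x ⬝ᵥ (Z *ᵥ y) = y ⬝ᵥ (Z *ᵥ x) := by
  rw [Matrix.dotProduct_mulVec, ← Matrix.mulVec_transpose, hZ.eq, dotProduct_comm]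

lemma star_pos {Z : Matrix ι ι ℂ} (hZ : Z.IsSymm) (hp : ImPos Z) (v : ι → ℂ) (hv : v ≠ 0) :
    0 < (star v ⬝ᵥ (Z *ᵥ v)).im := by
  set x : ι → ℝ := fun i => (v i).re with hx
  set y : ι → ℝ := fun i => (v i).im with hy
  have h1 : v = rcv x + Complex.I • rcv y := by
    ext i; simp [rcv, hx, hy, mul_comm Complex.I, Complex.re_add_im]
  have h2 : star v = rcv x - Complex.I • rcv y := by
    ext i; apply Complex.ext <;> simp [rcv, hx, hy]
  have h3 : star v ⬝ᵥ (Z *ᵥ v) = qfm Z (rcv x) + qfm Z (rcv y) := by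
    rw [h2]
    conv_lhs => rw [h1]
    simp only [qfm, Matrix.mulVec_add, Matrix.mulVec_smul, dotProduct_add, sub_dotProduct,
      smul_dotProduct, dotProduct_smul, smul_eq_mul]
    rw [symm_dot hZ (rcv y) (rcv x)]
    linear_combination (- (rcv y ⬝ᵥ Z *ᵥ rcv y)) * Complex.I_mul_I
  have hnn : ∀ w : ι → ℝ, 0 ≤ (qfm Z (rcv w)).im := by
    intro w
    by_cases hw : w = 0
    · subst hw
      have : rcv (0 : ι → ℝ) = 0 := by ext i; simp [rcv]
      simp [qfm, this]
    · exact (hp w hw).le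
  rw [h3, Complex.add_im]
  by_cases hx0 : x = 0
  · have hy0 : y ≠ 0 := by
      intro hy0
      apply hv
      rw [h1, hx0, hy0]
      ext i; simp [rcv]
    linarith [hnn x, hp y hy0]
  · linarith [hnn y, hp x hx0]

variable [DecidableEq ι]

lemma det_unit {Z : Matrix ι ι ℂ} (hZ : Z.IsSymm) (hp : ImPos Z) : IsUnit Z.det := by
  rw [isUnit_iff_ne_zero]
  intro h
  obtain ⟨v, hv, h0⟩ := Matrix.exists_mulVec_eq_zero_iff.mpr h
  have := star_pos hZ hp v hv
  rw [h0] at this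
  simp at this

lemma impos_inv {Z : Matrix ι ι ℂ} (hZ : Z.IsSymm) (hp : ImPos Z) : ImPos (-Z⁻¹) := by
  intro x hx
  have hu := det_unit hZ hp
  set v := Z⁻¹ *ᵥ rcv x with hv
  have hZv : Z *ᵥ v = rcv x := by
    rw [hv, Matrix.mulVec_mulVec, Matrix.mul_nonsing_inv _ hu, Matrix.one_mulVec]
  have hv0 : v ≠ 0 := by
    intro h
    rw [h, Matrix.mulVec_zero] at hZv
    apply hx
    ext i
    have := congrFun hZv i
    simpa [rcv] using this.symm
  have h := star_pos hZ hp v hv0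
  rw [hZv] at h
  have h2 : qfm (-Z⁻¹) (rcv x) = - star (star v ⬝ᵥ rcv x) := by
    rw [qfm, Matrix.neg_mulVec, ← hv]
    simp [dotProduct, rcv, mul_comm]
  rw [h2]
  simpa using h

lemma inv_symm {Z : Matrix ι ι ℂ} (hZ : Z.IsSymm) : Z⁻¹.IsSymm := by
  rw [Matrix.IsSymm, Matrix.transpose_nonsing_inv, hZ.eq]

/-! ### Summability -/

lemma summable_prod_pi (g : ℤ → ℝ) (h0 : ∀ k, 0 ≤ g k) (hg : Summable g) :
    Summable (fun ξ : ι → ℤ => ∏ i, g (ξ i)) := by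
  refine summable_of_sum_le (c := ∏ _i : ι, ∑' k, g k)
    (fun ξ => Finset.prod_nonneg fun i _ => h0 _) ?_
  intro u
  have hsub : u ⊆ Fintype.piFinset (fun i => u.image (fun ξ => ξ i)) := by
    intro ξ hξ
    rw [Fintype.mem_piFinset]
    intro i
    exact Finset.mem_image_of_mem _ hξ
  calc ∑ ξ ∈ u, ∏ i, g (ξ i)
      ≤ ∑ ξ ∈ Fintype.piFinset (fun i => u.image (fun ξ => ξ i)), ∏ i, g (ξ i) :=
        Finset.sum_le_sum_of_subset_of_nonneg hsub
          (fun ξ _ _ => Finset.prod_nonneg fun i _ => h0 _)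
    _ = ∏ i, ∑ k ∈ u.image (fun ξ => ξ i), g k := (Finset.prod_univ_sum _ _).symm
    _ ≤ ∏ _i : ι, ∑' k, g k := Finset.prod_le_prod
        (fun i _ => Finset.sum_nonneg fun k _ => h0 k)
        (fun i _ => hg.sum_le_tsum _ (fun k _ => h0 k))

lemma coercive {Z : Matrix ι ι ℂ} (hp : ImPos Z) :
    ∃ ε > 0, ∀ x : ι → ℝ, ε * ∑ i, x i ^ 2 ≤ (qfm Z (rcv x)).im := by
  have hc : Continuous (fun x : ι → ℝ => (qfm Z (rcv x)).im) := by
    unfold qfm rcv dotProduct Matrix.mulVec dotProduct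
    fun_prop
  obtain ⟨δ, hδ, hmin⟩ := (isCompact_sphere (0 : ι → ℝ) 1).exists_forall_le' (a := 0)
    hc.continuousOn (by
      intro x hx
      apply hp
      intro h
      rw [h] at hx
      simp at hx)
  refine ⟨δ / (Fintype.card ι + 1), by positivity, ?_⟩
  intro x
  by_cases hx : x = 0
  · subst hx
    have : rcv (0 : ι → ℝ) = 0 := by ext i; simp [rcv]
    simp [qfm, this]
  have hn : 0 < ‖x‖ := norm_pos_iff.mpr hx
  have h1 := hmin (‖x‖⁻¹ • x) (by simp [norm_smul, hn.ne'])
  have h2 : rcv (‖x‖⁻¹ • x) = ((‖x‖⁻¹ : ℝ) : ℂ) • rcv x := by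
    ext i; simp [rcv]
  have h3 : (qfm Z (rcv (‖x‖⁻¹ • x))).im = ‖x‖⁻¹ ^ 2 * (qfm Z (rcv x)).im := by
    rw [h2, qfm, Matrix.mulVec_smul, smul_dotProduct, dotProduct_smul, ← qfm, smul_eq_mul,
      smul_eq_mul, Complex.im_ofReal_mul, Complex.im_ofReal_mul]
    ring
  rw [h3] at h1
  have h4 : δ * ‖x‖ ^ 2 ≤ (qfm Z (rcv x)).im := by
    have := mul_le_mul_of_nonneg_right h1 (sq_nonneg ‖x‖)
    calc δ * ‖x‖ ^ 2 ≤ _ := this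
      _ = _ := by field_simp
  have h5 : ∑ i, x i ^ 2 ≤ (Fintype.card ι + 1) * ‖x‖ ^ 2 := by
    calc ∑ i, x i ^ 2 ≤ ∑ _i : ι, ‖x‖ ^ 2 := by
          apply Finset.sum_le_sum
          intro i _
          rw [← sq_abs]
          exact pow_le_pow_left₀ (abs_nonneg _) (norm_le_pi_norm x i) 2
      _ = Fintype.card ι * ‖x‖ ^ 2 := by simp
      _ ≤ _ := by nlinarith [sq_nonneg ‖x‖]
  calc δ / (Fintype.card ι + 1) * ∑ i, x i ^ 2
      ≤ δ / (Fintype.card ι + 1) * ((Fintype.card ι + 1) * ‖x‖ ^ 2) := by gcongr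
    _ = δ * ‖x‖ ^ 2 := by field_simp
    _ ≤ _ := h4

lemma summ_gen {Z : Matrix ι ι ℂ} (hp : ImPos Z) (z : ι → ℂ) (c : ℂ) :
    Summable (fun ξ : ι → ℤ =>
      Complex.exp (Real.pi * Complex.I * (qfm Z (icv ξ) + 2 * (icv ξ ⬝ᵥ z) + c))) := by
  obtain ⟨ε, hε, hco⟩ := coercive hp
  set M := ∑ i, |(z i).im| with hM
  have hg := summable_pow_mul_jacobiTheta₂_term_bound M hε 0
  simp only [pow_zero, one_mul] at hg
  have hP := summable_prod_pi (ι := ι) _ (fun k => (Real.exp_pos _).le) hg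
  refine Summable.of_norm_bounded (hP.mul_left (Real.exp (-Real.pi * c.im))) ?_
  intro ξ
  rw [Complex.norm_exp, ← Real.exp_sum, ← Real.exp_add, Real.exp_le_exp]
  have h1 : (Real.pi * Complex.I * (qfm Z (icv ξ) + 2 * (icv ξ ⬝ᵥ z) + c)).re
      = - Real.pi * ((qfm Z (icv ξ)).im + 2 * ∑ i, (ξ i : ℝ) * (z i).im + c.im) := by
    have : (icv ξ ⬝ᵥ z).im = ∑ i, (ξ i : ℝ) * (z i).im := by
      simp [dotProduct, icv]
    simp [this]
  rw [h1]
  have h2 := hco (fun i => (ξ i : ℝ))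
  have h3 : rcv (fun i => (ξ i : ℝ)) = icv ξ := by ext i; simp [rcv, icv]
  rw [h3] at h2
  have h4 : - ∑ i, (ξ i : ℝ) * (z i).im ≤ M * ∑ i, |(ξ i : ℝ)| := by
    rw [← Finset.sum_neg_distrib, Finset.mul_sum]
    apply Finset.sum_le_sum
    intro i _
    have : |(z i).im| ≤ M :=
      Finset.single_le_sum (f := fun i => |(z i).im|) (fun i _ => abs_nonneg _) (Finset.mem_univ i)
    calc -((ξ i : ℝ) * (z i).im) ≤ |(ξ i : ℝ) * (z i).im| := neg_le_abs _
      _ = |(z i).im| * |(ξ i : ℝ)| := by rw [abs_mul, mul_comm]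
      _ ≤ _ := by gcongr
  have h5 : ∑ i, -Real.pi * (ε * (ξ i : ℝ) ^ 2 - 2 * M * |(ξ i : ℝ)|)
      = - Real.pi * (ε * ∑ i, (ξ i : ℝ) ^ 2 - 2 * (M * ∑ i, |(ξ i : ℝ)|)) := by
    rw [← Finset.mul_sum, Finset.sum_sub_distrib, ← Finset.mul_sum, ← Finset.mul_sum]
    ring
  try simp only [Int.cast_abs] at hg ⊢
  rw [h5]
  nlinarith [Real.pi_pos]

lemma qfm_sub {W : Matrix ι ι ℂ} (hW : W.IsSymm) (x z : ι → ℂ) :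
    qfm W (x - z) = qfm W x - 2 * (x ⬝ᵥ (W *ᵥ z)) + qfm W z := by
  simp only [qfm, Matrix.mulVec_sub, dotProduct_sub, sub_dotProduct]
  rw [symm_dot hW z x]; ring

lemma qfm_neg (W : Matrix ι ι ℂ) (x : ι → ℂ) : qfm (-W) x = - qfm W x := by
  simp [qfm, Matrix.neg_mulVec]

lemma summ_inv {Z : Matrix ι ι ℂ} (hZ : Z.IsSymm) (hp : ImPos Z) (z : ι → ℂ) :
    Summable (fun ξ : ι → ℤ =>
      Complex.exp (-(Real.pi * Complex.I * qfm Z⁻¹ (icv ξ - z)))) := by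
  have := summ_gen (impos_inv hZ hp) (Z⁻¹ *ᵥ z) (- qfm Z⁻¹ z)
  refine this.congr ?_
  intro ξ
  rw [qfm_sub (inv_symm hZ), qfm_neg]
  congr 1
  ring

end ThetaAux

section ThetaInduction

lemma theta_one (τ w : ℂ) :
    ∑' k : ℤ, Complex.exp (Real.pi * Complex.I * (τ * (k : ℂ) ^ 2 + 2 * ((k : ℂ) * w)))
      = 1 / (-Complex.I * τ) ^ (1 / 2 : ℂ) *
        ∑' k : ℤ, Complex.exp (-(Real.pi * Complex.I * (((k : ℂ) - w) ^ 2 / τ))) := by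
  have h := jacobiTheta₂_functional_equation w τ
  unfold jacobiTheta₂ jacobiTheta₂_term at h
  have h1 : ∀ k : ℤ, Complex.exp (Real.pi * Complex.I * (τ * (k : ℂ) ^ 2 + 2 * ((k : ℂ) * w)))
      = Complex.exp (2 * Real.pi * Complex.I * k * w + Real.pi * Complex.I * k ^ 2 * τ) := by
    intro k; congr 1; ring
  have h2 : ∀ k : ℤ, Complex.exp (-(Real.pi * Complex.I * (((k : ℂ) - w) ^ 2 / τ)))
      = Complex.exp (-Real.pi * Complex.I * w ^ 2 / τ) * Complex.exp (2 * Real.pi * Complex.I * k *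
        (w / τ) + Real.pi * Complex.I * k ^ 2 * (-1 / τ)) := by
    intro k; rw [← Complex.exp_add]; congr 1; ring
  simp only [h1, h2, tsum_mul_left]
  rw [h]
  ring

/-- The inductive statement. -/
def ThetaP (ι : Type) [Fintype ι] : Prop :=
  ∀ [DecidableEq ι] (Z : Matrix ι ι ℂ), Z.IsSymm → ImPos Z →
    ∃ c : ℂ, c ^ 2 * (Complex.I⁻¹ • Z).det = 1 ∧ ∀ z : ι → ℂ,
      ∑' ξ : ι → ℤ, Complex.exp (Real.pi * Complex.I * (qfm Z (icv ξ) + 2 * (icv ξ ⬝ᵥ z)))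
        = c * ∑' ξ : ι → ℤ, Complex.exp (-(Real.pi * Complex.I * qfm Z⁻¹ (icv ξ - z)))

lemma dot_comp_equiv {α β : Type} [Fintype α] [Fintype β] (e : α ≃ β) (x y : β → ℂ) :
    (x ∘ e) ⬝ᵥ (y ∘ e) = x ⬝ᵥ y := by
  simp only [dotProduct, Function.comp]
  exact e.sum_comp (fun i => x i * y i)

lemma qfm_comp {α β : Type} [Fintype α] [Fintype β] (e : α ≃ β) (Z : Matrix β β ℂ) (x : β → ℂ) :
    qfm (Z.submatrix e e) (x ∘ e) = qfm Z x := by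
  have : (Z.submatrix e e) *ᵥ (x ∘ e) = (Z *ᵥ x) ∘ e := by
    ext i
    simp only [Matrix.mulVec, Function.comp]
    exact dot_comp_equiv e (fun j => Z (e i) j) x
  rw [qfm, this, dot_comp_equiv, qfm]

lemma thetaP_equiv {α β : Type} [Fintype α] [Fintype β] (e : α ≃ β) (h : ThetaP α) : ThetaP β := by
  classical
  intro _ Z hZ hp
  obtain ⟨c, hc, hs⟩ := h (Z.submatrix e e) (by
      rw [Matrix.IsSymm, Matrix.transpose_submatrix, hZ.eq]) (by
      intro x hx
      have h1 : rcv x = rcv (x ∘ e.symm) ∘ e := by ext i; simp [rcv]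
      rw [h1, qfm_comp]
      apply hp
      intro h0
      apply hx
      ext i
      simpa using congrFun h0 (e i))
  refine ⟨c, ?_, ?_⟩
  · have h0 : Complex.I⁻¹ • Z.submatrix e e = (Complex.I⁻¹ • Z).submatrix e e := rfl
    rw [← hc, h0, Matrix.det_submatrix_equiv_self]
  · intro z
    have h1 := hs (z ∘ e)
    rw [← (Equiv.arrowCongr e.symm (Equiv.refl ℤ)).tsum_eq,
      ← (Equiv.arrowCongr e.symm (Equiv.refl ℤ)).tsum_eq
        (fun ξ => Complex.exp (-(Real.pi * Complex.I * qfm _ (icv ξ - z ∘ e))))] at h1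
    have h2 : ∀ ξ : β → ℤ, icv ((Equiv.arrowCongr e.symm (Equiv.refl ℤ)) ξ) = icv ξ ∘ e := by
      intro ξ; ext i; simp [icv, Equiv.arrowCongr]
    have h3 : ∀ ξ : β → ℤ, icv ξ ∘ e - z ∘ e = (icv ξ - z) ∘ e := by
      intro ξ; rfl
    simp only [h2, h3, Matrix.inv_submatrix_equiv, qfm_comp, dot_comp_equiv] at h1
    exact h1

variable {α : Type} [Fintype α]

/-- Splitting off the last coordinate. -/
def splitLast (α R : Type) : (α → R) × R ≃ (α ⊕ Unit → R) where
  toFun p := Sum.elim p.1 (fun _ => p.2)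
  invFun f := (fun i => f (Sum.inl i), f (Sum.inr ()))
  left_inv p := rfl
  right_inv f := by ext (i | i) <;> rfl

lemma splitLast_inl {β R : Type} (p : (β → R) × R) (i : β) :
    splitLast β R p (Sum.inl i) = p.1 i := rfl

lemma splitLast_inr {β R : Type} (p : (β → R) × R) (i : Unit) :
    splitLast β R p (Sum.inr i) = p.2 := rfl

lemma dot_split (x y : α → ℂ) (s t : ℂ) :
    splitLast α ℂ (x, s) ⬝ᵥ splitLast α ℂ (y, t) = x ⬝ᵥ y + s * t := by
  simp [dotProduct, splitLast_inl, splitLast_inr]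

lemma icv_split (ξ : α → ℤ) (k : ℤ) :
    icv (splitLast α ℤ (ξ, k)) = splitLast α ℂ (icv ξ, (k : ℂ)) := by
  ext (i | i) <;> rfl

lemma rcv_split (ξ : α → ℝ) (k : ℝ) :
    rcv (splitLast α ℝ (ξ, k)) = splitLast α ℂ (rcv ξ, (k : ℂ)) := by
  ext (i | i) <;> rfl

lemma split_sub (x y : α → ℂ) (s t : ℂ) :
    splitLast α ℂ (x, s) - splitLast α ℂ (y, t) = splitLast α ℂ (x - y, s - t) := by
  ext (i | i) <;> rfl

/-- A symmetric block matrix with a one dimensional second block. -/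
def blk (A : Matrix α α ℂ) (b : α → ℂ) (τ : ℂ) : Matrix (α ⊕ Unit) (α ⊕ Unit) ℂ :=
  Matrix.fromBlocks A (Matrix.of fun i _ => b i) (Matrix.of fun _ i => b i)
    (Matrix.of fun _ _ => τ)

lemma blk_mulVec (A : Matrix α α ℂ) (b : α → ℂ) (τ : ℂ) (x : α → ℂ) (t : ℂ) :
    blk A b τ *ᵥ splitLast α ℂ (x, t) = splitLast α ℂ (A *ᵥ x + t • b, b ⬝ᵥ x + τ * t) := by
  ext (i | i) <;> simp [blk, splitLast_inl, splitLast_inr, Matrix.mulVec, dotProduct, mul_comm]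

lemma qfm_blk (A : Matrix α α ℂ) (b : α → ℂ) (τ : ℂ) (x : α → ℂ) (t : ℂ) :
    qfm (blk A b τ) (splitLast α ℂ (x, t)) = qfm A x + 2 * (t * (b ⬝ᵥ x)) + τ * t ^ 2 := by
  rw [qfm, blk_mulVec, dot_split, dotProduct_add, dotProduct_smul, ← qfm, dotProduct_comm x b,
    smul_eq_mul]
  ring

lemma exists_blk (Z : Matrix (α ⊕ Unit) (α ⊕ Unit) ℂ) (hZ : Z.IsSymm) :
    ∃ A b τ, A.IsSymm ∧ Z = blk A b τ := by
  refine ⟨Z.toBlocks₁₁, fun i => Z (Sum.inl i) (Sum.inr ()), Z (Sum.inr ()) (Sum.inr ()), ?_, ?_⟩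
  · ext i j; exact hZ.apply _ _
  · ext (i | i) (j | j)
    · rfl
    · rfl
    · exact hZ.apply _ _
    · rfl

lemma star_split (x : α → ℂ) (t : ℂ) :
    star (splitLast α ℂ (x, t)) = splitLast α ℂ (star x, star t) := by
  ext (i | i) <;> rfl

/-- The mixed form. -/
lemma mixed_pos {A : Matrix α α ℂ} {b : α → ℂ} {τ : ℂ} (hZ : (blk A b τ).IsSymm)
    (hp : ImPos (blk A b τ)) (hτ : τ ≠ 0) (x : α → ℝ) (k : ℝ) (h : ¬ (x = 0 ∧ k = 0)) :
    0 < (qfm A (rcv x) - ((k : ℂ) - b ⬝ᵥ rcv x) ^ 2 / τ).im := by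
  set β := b ⬝ᵥ rcv x with hβ
  set w := ((k : ℂ) - β) / τ with hw
  have hv : splitLast α ℂ (rcv x, w) ≠ 0 := by
    intro h0
    have hx : x = 0 := by
      ext i
      have := congrFun h0 (Sum.inl i)
      simpa [splitLast_inl, rcv] using this
    have hw0 : w = 0 := congrFun h0 (Sum.inr ())
    apply h
    refine ⟨hx, ?_⟩
    have hβ0 : β = 0 := by
      rw [hβ, hx]; simp [dotProduct, rcv]
    rw [hw, hβ0, sub_zero, div_eq_zero_iff] at hw0
    rcases hw0 with h1 | h1
    · exact_mod_cast h1
    · exact absurd h1 hτ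
  have h1 := star_pos hZ hp _ hv
  have hr : star (rcv x) = rcv x := by ext i; simp [rcv]
  rw [blk_mulVec, star_split, dot_split, hr, dotProduct_add, dotProduct_smul, ← qfm,
    dotProduct_comm (rcv x) b, ← hβ, smul_eq_mul] at h1
  have h2 : β + τ * w = k := by rw [hw]; field_simp; ring
  have h3 : qfm A (rcv x) - ((k : ℂ) - β) ^ 2 / τ = qfm A (rcv x) + w * β - w * k := by
    rw [hw]; field_simp; ring
  rw [h2] at h1
  rw [h3]
  simp only [Complex.add_im, Complex.sub_im] at h1 ⊢
  have h4 : (star w * (k : ℂ)).im = - (w * k).im := by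
    simp
  rw [h4] at h1
  linarith

lemma tau_ne {A : Matrix α α ℂ} {b : α → ℂ} {τ : ℂ}
    (hp : ImPos (blk A b τ)) : τ ≠ 0 := by
  have h := hp (splitLast α ℝ (0, 1)) (by
    intro h
    have := congrFun h (Sum.inr ())
    simp [splitLast_inr] at this)
  rw [rcv_split, qfm_blk] at h
  have h0 : rcv (0 : α → ℝ) = 0 := by ext i; simp [rcv]
  rintro rfl
  simp [h0, qfm] at h

/-- Schur complement. -/
noncomputable def schur (A : Matrix α α ℂ) (b : α → ℂ) (τ : ℂ) : Matrix α α ℂ :=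
  A - τ⁻¹ • Matrix.vecMulVec b b

lemma schur_mulVec (A : Matrix α α ℂ) (b : α → ℂ) (τ : ℂ) (x : α → ℂ) :
    schur A b τ *ᵥ x = A *ᵥ x - (τ⁻¹ * (b ⬝ᵥ x)) • b := by
  rw [schur, Matrix.sub_mulVec, Matrix.smul_mulVec, Matrix.vecMulVec_mulVec]
  ext i; simp; ring

lemma qfm_schur (A : Matrix α α ℂ) (b : α → ℂ) (τ : ℂ) (x : α → ℂ) :
    qfm (schur A b τ) x = qfm A x - (b ⬝ᵥ x) ^ 2 / τ := by
  rw [qfm, schur_mulVec, dotProduct_sub, dotProduct_smul, ← qfm, dotProduct_comm x b, smul_eq_mul]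
  ring

lemma schur_symm {A : Matrix α α ℂ} (hA : A.IsSymm) (b : α → ℂ) (τ : ℂ) :
    (schur A b τ).IsSymm := by
  ext i j
  simp [schur, Matrix.vecMulVec_apply, hA.apply i j, mul_comm]

lemma schur_pos {A : Matrix α α ℂ} {b : α → ℂ} {τ : ℂ} (hZ : (blk A b τ).IsSymm)
    (hp : ImPos (blk A b τ)) : ImPos (schur A b τ) := by
  intro x hx
  have := mixed_pos hZ hp (tau_ne hp) x 0 (fun h => hx h.1)
  rw [qfm_schur]
  simpa using this

lemma det_blk [DecidableEq α] (A : Matrix α α ℂ) (b : α → ℂ) (τ : ℂ) (hτ : τ ≠ 0) :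
    (blk A b τ).det = τ * (schur A b τ).det := by
  let iD : Invertible (Matrix.of fun (_ _ : Unit) => τ) :=
    ⟨Matrix.of fun _ _ => τ⁻¹, by ext; simp [Matrix.mul_apply, hτ],
      by ext; simp [Matrix.mul_apply, hτ]⟩
  rw [blk, Matrix.det_fromBlocks₂₂]
  congr 1
  · simp
  · congr 1
    ext i j
    have : ⅟(Matrix.of fun (_ _ : Unit) => τ) = Matrix.of fun _ _ => τ⁻¹ := rfl
    rw [this]
    simp [schur, Matrix.mul_apply, Matrix.vecMulVec_apply]
    ring

lemma qfm_inv_blk [DecidableEq α] {A : Matrix α α ℂ} {b : α → ℂ} {τ : ℂ} (hτ : τ ≠ 0)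
    (hu : IsUnit (blk A b τ).det) (hD : IsUnit (schur A b τ).det) (x : α → ℂ) (t : ℂ) :
    qfm (blk A b τ)⁻¹ (splitLast α ℂ (x, t))
      = t ^ 2 / τ + qfm (schur A b τ)⁻¹ (x - (t / τ) • b) := by
  set y := (schur A b τ)⁻¹ *ᵥ (x - (t / τ) • b) with hy
  have hDy : schur A b τ *ᵥ y = x - (t / τ) • b := by
    rw [hy, Matrix.mulVec_mulVec, Matrix.mul_nonsing_inv _ hD, Matrix.one_mulVec]
  rw [schur_mulVec] at hDy
  set s := (t - b ⬝ᵥ y) / τ with hs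
  have h1 : blk A b τ *ᵥ splitLast α ℂ (y, s) = splitLast α ℂ (x, t) := by
    rw [blk_mulVec]
    congr 2
    · have : A *ᵥ y = x - (t / τ) • b + (τ⁻¹ * (b ⬝ᵥ y)) • b := by rw [← hDy]; simp
      rw [this]
      ext i
      simp [hs]
      ring
    · rw [hs]; field_simp; ring
  have h2 : (blk A b τ)⁻¹ *ᵥ splitLast α ℂ (x, t) = splitLast α ℂ (y, s) := by
    rw [← h1, Matrix.mulVec_mulVec, Matrix.nonsing_inv_mul _ hu, Matrix.one_mulVec]
  rw [qfm, h2, dot_split, qfm, ← hy, sub_dotProduct, smul_dotProduct, hs, smul_eq_mul]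
  ring

lemma thetaP_sum (h : ThetaP α) : ThetaP (α ⊕ Unit) := by
  classical
  intro hdec Z hZ hp
  have : hdec = instDecidableEqSum := Subsingleton.elim _ _
  subst this
  obtain ⟨A, b, τ, hA, rfl⟩ := exists_blk Z hZ
  have hτ := tau_ne hp
  have hDs := schur_symm hA b τ
  have hDp := schur_pos hZ hp
  have hu := det_unit hZ hp
  have hDu := det_unit hDs hDp
  obtain ⟨c₂, hc₂, ih⟩ := h (schur A b τ) hDs hDp
  set c₁ : ℂ := 1 / (-Complex.I * τ) ^ (1 / 2 : ℂ) with hc₁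
  have hc₁2 : c₁ ^ 2 * (Complex.I⁻¹ * τ) = 1 := by
    rw [hc₁, div_pow, ← Complex.cpow_nat_mul]
    have : (-Complex.I * τ) ≠ 0 := by simp [hτ]
    simp only [Nat.cast_ofNat, one_div, ne_eq, OfNat.ofNat_ne_zero, not_false_eq_true,
      mul_inv_cancel₀, Complex.cpow_one, Complex.inv_I, one_pow]
    exact inv_mul_cancel₀ this
  refine ⟨c₁ * c₂, ?_, ?_⟩
  · have h1 : Complex.I⁻¹ • blk A b τ
        = blk (Complex.I⁻¹ • A) (Complex.I⁻¹ • b) (Complex.I⁻¹ * τ) := by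
      ext (i | i) (j | j) <;> simp [blk]
    have h2 : schur (Complex.I⁻¹ • A) (Complex.I⁻¹ • b) (Complex.I⁻¹ * τ)
        = Complex.I⁻¹ • schur A b τ := by
      ext i j
      simp only [schur, Matrix.sub_apply, Matrix.smul_apply, Matrix.vecMulVec_apply, Pi.smul_apply,
        smul_eq_mul]
      have := Complex.I_ne_zero
      field_simp
    rw [h1, det_blk _ _ _ (mul_ne_zero (inv_ne_zero Complex.I_ne_zero) hτ), h2]
    linear_combination (c₂ ^ 2 * (Complex.I⁻¹ • schur A b τ).det) * hc₁2 + hc₂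
  · intro z
    obtain ⟨⟨z', s⟩, rfl⟩ := (splitLast α ℂ).surjective z
    -- the three families
    let F : (α → ℤ) × ℤ → ℂ := fun p => Complex.exp (Real.pi * Complex.I *
      (qfm (blk A b τ) (icv (splitLast α ℤ p)) + 2 * (icv (splitLast α ℤ p) ⬝ᵥ splitLast α ℂ (z', s))))
    let G : (α → ℤ) × ℤ → ℂ := fun p => Complex.exp (Real.pi * Complex.I *
      (qfm A (icv p.1) + 2 * (icv p.1 ⬝ᵥ z') - ((p.2 : ℂ) - (b ⬝ᵥ icv p.1 + s)) ^ 2 / τ))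
    let H : (α → ℤ) × ℤ → ℂ := fun p => Complex.exp (-(Real.pi * Complex.I *
      qfm (blk A b τ)⁻¹ (icv (splitLast α ℤ p) - splitLast α ℂ (z', s))))
    have hF : Summable F := by
      have := summ_gen hp (splitLast α ℂ (z', s)) 0
      simp only [add_zero] at this
      exact (splitLast α ℤ).summable_iff.mpr this
    have hH : Summable H :=
      (splitLast α ℤ).summable_iff.mpr (summ_inv hZ hp (splitLast α ℂ (z', s)))
    have hG : Summable G := by
      have hM : ImPos (blk (schur A b τ) (τ⁻¹ • b) (-τ⁻¹)) := by
        intro x hx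
        obtain ⟨⟨x', k⟩, rfl⟩ := (splitLast α ℝ).surjective x
        have h1 := mixed_pos hZ hp hτ x' k (by
          rintro ⟨rfl, rfl⟩
          apply hx
          ext (i | i) <;> rfl)
        rw [rcv_split, qfm_blk, qfm_schur, smul_dotProduct]
        convert h1 using 2
        rw [smul_eq_mul]
        ring
      have h2 := (splitLast α ℤ).summable_iff.mpr
        (summ_gen hM (splitLast α ℂ (z' - (s / τ) • b, s / τ)) (- s ^ 2 / τ))
      refine h2.congr ?_
      rintro ⟨ξ, k⟩
      simp only [G, Function.comp]
      rw [icv_split, qfm_blk, qfm_schur, dot_split, dotProduct_sub, smul_dotProduct,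
        dotProduct_smul, dotProduct_comm (icv ξ) b, smul_eq_mul, smul_eq_mul]
      congr 1
      ring
    have e1 : ∀ ξ : α → ℤ, ∑' k : ℤ, F (ξ, k) = c₁ * ∑' k : ℤ, G (ξ, k) := by
      intro ξ
      have h1 := theta_one τ (b ⬝ᵥ icv ξ + s)
      rw [← hc₁] at h1
      have h2 : ∀ k : ℤ, F (ξ, k) = Complex.exp (Real.pi * Complex.I *
          (qfm A (icv ξ) + 2 * (icv ξ ⬝ᵥ z'))) * Complex.exp (Real.pi * Complex.I *
          (τ * (k : ℂ) ^ 2 + 2 * ((k : ℂ) * (b ⬝ᵥ icv ξ + s)))) := by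
        intro k
        simp only [F]
        rw [← Complex.exp_add, icv_split, qfm_blk, dot_split]
        congr 1
        ring
      have h3 : ∀ k : ℤ, G (ξ, k) = Complex.exp (Real.pi * Complex.I *
          (qfm A (icv ξ) + 2 * (icv ξ ⬝ᵥ z'))) * Complex.exp (-(Real.pi * Complex.I *
          (((k : ℂ) - (b ⬝ᵥ icv ξ + s)) ^ 2 / τ))) := by
        intro k
        simp only [G]
        rw [← Complex.exp_add]
        congr 1
        ring
      simp only [h2, h3, tsum_mul_left]
      rw [h1]
      ring
    have e2 : ∀ k : ℤ, ∑' ξ : α → ℤ, G (ξ, k) = c₂ * ∑' ξ : α → ℤ, H (ξ, k) := by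
      intro k
      have h1 := ih (z' + (((k : ℂ) - s) / τ) • b)
      have h2 : ∀ ξ : α → ℤ, G (ξ, k) = Complex.exp (-(Real.pi * Complex.I *
          (((k : ℂ) - s) ^ 2 / τ))) * Complex.exp (Real.pi * Complex.I *
          (qfm (schur A b τ) (icv ξ) + 2 * (icv ξ ⬝ᵥ (z' + (((k : ℂ) - s) / τ) • b)))) := by
        intro ξ
        simp only [G]
        rw [← Complex.exp_add, qfm_schur, dotProduct_add, dotProduct_smul,
          dotProduct_comm (icv ξ) b, smul_eq_mul]
        congr 1
        ring
      have h3 : ∀ ξ : α → ℤ, H (ξ, k) = Complex.exp (-(Real.pi * Complex.I *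
          (((k : ℂ) - s) ^ 2 / τ))) * Complex.exp (-(Real.pi * Complex.I *
          qfm (schur A b τ)⁻¹ (icv ξ - (z' + (((k : ℂ) - s) / τ) • b)))) := by
        intro ξ
        simp only [H]
        rw [← Complex.exp_add, icv_split, split_sub, qfm_inv_blk hτ hu hDu, sub_sub]
        congr 1
        ring
      simp only [h2, h3, tsum_mul_left]
      rw [h1]
      ring
    rw [← (splitLast α ℤ).tsum_eq, ← (splitLast α ℤ).tsum_eq
      (fun ξ => Complex.exp (-(Real.pi * Complex.I * qfm (blk A b τ)⁻¹ (icv ξ - _))))]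
    change ∑' p, F p = c₁ * c₂ * ∑' p, H p
    calc ∑' p, F p = ∑' ξ, ∑' k, F (ξ, k) := hF.tsum_prod
      _ = c₁ * ∑' ξ, ∑' k, G (ξ, k) := by simp only [e1, tsum_mul_left]
      _ = c₁ * ∑' k, ∑' ξ, G (ξ, k) := by 
          rw [Summable.tsum_comm (f := fun ξ k => G (ξ, k)) hG]
      _ = c₁ * c₂ * ∑' k, ∑' ξ, H (ξ, k) := by simp only [e2, tsum_mul_left]; ring
      _ = c₁ * c₂ * ∑' ξ, ∑' k, H (ξ, k) := by 
          rw [Summable.tsum_comm (f := fun ξ k => H (ξ, k)) hH]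
      _ = c₁ * c₂ * ∑' p, H p := by rw [hH.tsum_prod]

theorem thetaP_all (ι : Type) [Fintype ι] : ThetaP ι := by
  refine Fintype.induction_empty_option (P := fun ι _ => ThetaP ι) ?_ ?_ ?_ ι
  · intro α β iβ e h
    exact @thetaP_equiv α β (Fintype.ofEquiv β e.symm) iβ e @h
  · intro _ Z _ _
    refine ⟨1, by simp, ?_⟩
    intro z
    simp [qfm, dotProduct]
  · intro α _ h
    exact thetaP_equiv (Equiv.optionEquivSumPUnit α).symm (thetaP_sum h)

end ThetaInduction

open scoped Kronecker

lemma trace_eq_qfm {m n : ℕ} (R : Matrix (Fin m) (Fin m) ℂ) (Ω : Matrix (Fin n) (Fin n) ℂ)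
    (hΩ : Ω.IsSymm) (ξ : Matrix (Fin m) (Fin n) ℂ) :
    Matrix.trace (R * ξ * Ω * ξᵀ) = qfm (R ⊗ₖ Ω) (fun p => ξ p.1 p.2) := by
  have h : (R ⊗ₖ Ω) *ᵥ (fun p : Fin m × Fin n => ξ p.1 p.2)
      = fun p => (R * ξ * Ωᵀ) p.1 p.2 := by
    ext ⟨i, j⟩
    simp only [Matrix.mulVec, dotProduct, Fintype.sum_prod_type, Matrix.kroneckerMap_apply,
      Matrix.mul_apply, Matrix.transpose_apply, Finset.sum_mul]
    rw [Finset.sum_comm]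
    refine Finset.sum_congr rfl fun l _ => Finset.sum_congr rfl fun k _ => ?_
    ring
  rw [qfm, h, hΩ.eq]
  simp only [Matrix.trace, Matrix.diag_apply, dotProduct, Fintype.sum_prod_type]
  refine Finset.sum_congr rfl fun i _ => ?_
  rw [Matrix.mul_apply]
  refine Finset.sum_congr rfl fun j _ => ?_
  rw [Matrix.transpose_apply, mul_comm]

/-- Matrices as functions on pairs. -/
def pairEquiv (m n : ℕ) : Matrix (Fin m) (Fin n) ℤ ≃ (Fin m × Fin n → ℤ) :=
  (Equiv.curry (Fin m) (Fin n) ℤ).symm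

lemma qfm_im {ι : Type} [Fintype ι] (Z : Matrix ι ι ℂ) (x : ι → ℝ) :
    (qfm Z (rcv x)).im = x ⬝ᵥ ((Matrix.of fun i j => (Z i j).im) *ᵥ x) := by
  simp [qfm, rcv, dotProduct, Matrix.mulVec]

lemma posDef_iff_imPos {ι : Type} [Fintype ι] {Z : Matrix ι ι ℂ} (hZ : Z.IsSymm) :
    (Matrix.of fun i j => (Z i j).im).PosDef ↔ ImPos Z := by
  rw [Matrix.posDef_iff_dotProduct_mulVec]
  constructor
  · rintro ⟨_, h⟩ x hx
    rw [qfm_im]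
    simpa using h hx
  · intro h
    refine ⟨?_, ?_⟩
    · ext i j
      simp [hZ.apply i j]
    · intro x hx
      have := h x hx
      rw [qfm_im] at this
      simpa using this

/-- Theta inversion: `−Ω⁻¹ ∈ H_n`, both theta series converge absolutely, and
`θ_{S⁻¹}(−Ω⁻¹)² = (det S)^n det(Ω/i)^m θ_S(Ω)²`. -/
theorem stmt16 {m n : ℕ} (S : Matrix (Fin m) (Fin m) ℝ) (hSpos : S.PosDef) (hSsymm : S.IsSymm)
    (hSint : ∀ i j, ∃ z : ℤ, S i j = (z : ℝ))
    (Ω : Matrix (Fin n) (Fin n) ℂ) (hΩsymm : Ω.IsSymm)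
    (hΩim : (Matrix.of fun i j => (Ω i j).im).PosDef) :
    ((-Ω⁻¹).IsSymm ∧ (Matrix.of fun i j => ((-Ω⁻¹) i j).im).PosDef) ∧
    Summable (fun ξ : Matrix (Fin m) (Fin n) ℤ => ‖thetaSTerm S Ω ξ‖) ∧
    Summable (fun ξ : Matrix (Fin m) (Fin n) ℤ => ‖thetaSTerm S⁻¹ (-Ω⁻¹) ξ‖) ∧
    (thetaS S⁻¹ (-Ω⁻¹)) ^ 2 =
      (Complex.ofReal S.det) ^ n * ((Complex.I⁻¹ • Ω).det) ^ m * (thetaS S Ω) ^ 2 := by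
  set Sc : Matrix (Fin m) (Fin m) ℂ := S.map Complex.ofReal with hSc
  have hΩp : ImPos Ω := (posDef_iff_imPos hΩsymm).mp hΩim
  have hWs : (-Ω⁻¹).IsSymm := (inv_symm hΩsymm).neg
  have hWp : ImPos (-Ω⁻¹) := impos_inv hΩsymm hΩp
  set Z : Matrix (Fin m × Fin n) (Fin m × Fin n) ℂ := Sc ⊗ₖ Ω with hZdef
  have hZs : Z.IsSymm := by
    ext ⟨i, j⟩ ⟨k, l⟩
    simp [hZdef, hSc, hSsymm.apply i k, hΩsymm.apply j l]
  have hZp : ImPos Z := by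
    rw [← posDef_iff_imPos hZs]
    have h1 := hSpos.kronecker hΩim
    have h2 : (Matrix.of fun i j => (Z i j).im) = S ⊗ₖ (Matrix.of fun i j => (Ω i j).im) := by
      ext ⟨i, j⟩ ⟨k, l⟩
      simp [hZdef, hSc]
    rw [h2]
    exact h1
  have hSu : IsUnit S.det := isUnit_iff_ne_zero.mpr hSpos.det_pos.ne'
  have hSinv : S⁻¹.map Complex.ofReal = Sc⁻¹ := by
    symm
    apply Matrix.inv_eq_left_inv
    have h1 : (S⁻¹ * S).map Complex.ofReal = S⁻¹.map Complex.ofReal * Sc :=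
      Matrix.map_mul (f := Complex.ofRealHom)
    rw [← h1, Matrix.nonsing_inv_mul _ hSu]
    exact Matrix.map_one _ Complex.ofReal_zero Complex.ofReal_one
  have hZinv : Sc⁻¹ ⊗ₖ (-Ω⁻¹) = -Z⁻¹ := by
    rw [hZdef, Matrix.inv_kronecker]
    ext ⟨i, j⟩ ⟨k, l⟩
    simp
  have hvec : ∀ ξ : Matrix (Fin m) (Fin n) ℤ,
      (fun p : Fin m × Fin n => ξ.map (Int.cast : ℤ → ℂ) p.1 p.2) = icv (pairEquiv m n ξ) := by
    intro ξ; rfl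
  have t1 : ∀ ξ, thetaSTerm S Ω ξ
      = Complex.exp (Real.pi * Complex.I * qfm Z (icv (pairEquiv m n ξ))) := by
    intro ξ
    rw [thetaSTerm, trace_eq_qfm _ _ hΩsymm, hvec]
  have t2 : ∀ ξ, thetaSTerm S⁻¹ (-Ω⁻¹) ξ
      = Complex.exp (-(Real.pi * Complex.I * qfm Z⁻¹ (icv (pairEquiv m n ξ)))) := by
    intro ξ
    rw [thetaSTerm, trace_eq_qfm _ _ hWs, hvec, hSinv, hZinv, qfm_neg, mul_neg]
  have s1 := summ_gen hZp 0 0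
  have s2 := summ_inv hZs hZp 0
  obtain ⟨c, hc, hs⟩ := thetaP_all (Fin m × Fin n) Z hZs hZp
  have hs0 := hs 0
  simp only [dotProduct_zero, mul_zero, add_zero, sub_zero] at s1 s2 hs0
  refine ⟨⟨hWs, (posDef_iff_imPos hWs).mpr hWp⟩, ?_, ?_, ?_⟩
  · simp only [t1]
    exact ((pairEquiv m n).summable_iff.mpr s1).norm
  · simp only [t2]
    exact ((pairEquiv m n).summable_iff.mpr s2).norm
  · have hdet : (Complex.I⁻¹ • Z).det
        = (Complex.ofReal S.det) ^ n * ((Complex.I⁻¹ • Ω).det) ^ m := by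
      have h1 : Complex.I⁻¹ • Z = Sc ⊗ₖ (Complex.I⁻¹ • Ω) := by
        rw [hZdef, Matrix.kronecker_smul]
      have h2 : Sc.det = Complex.ofReal S.det := (Complex.ofRealHom.map_det S).symm
      rw [h1, Matrix.det_kronecker, h2, Fintype.card_fin, Fintype.card_fin]
    simp only [thetaS, t1, t2]
    rw [(pairEquiv m n).tsum_eq (fun ξ => Complex.exp (Real.pi * Complex.I * qfm Z (icv ξ))),
      (pairEquiv m n).tsum_eq (fun ξ => Complex.exp (-(Real.pi * Complex.I * qfm Z⁻¹ (icv ξ)))),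
      hs0, ← hdet, mul_pow]
    linear_combination (-(∑' ξ : Fin m × Fin n → ℤ,
      Complex.exp (-(Real.pi * Complex.I * qfm Z⁻¹ (icv ξ)))) ^ 2) * hc
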